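/- Let Z be a standard normal random variable and let v, c > 0. Then E[η(vZ, c)²] = 2·((v² + c²)·Q(c/v) − c·v·φ(c/v)), where η(x, t) = sign(x)·max(|x| − t, 0) is the soft-thresholding function, Q(t) = ∫_t^∞ e^{−x²/2}/√(2π) dx, and φ(t) = e^{−t²/2}/√(2π). -/

import Mathlib

/-- The soft-thresholding function η(x, t) = sign(x)·max(|x| − t, 0). -/
noncomputable def softThresh (x t : ℝ) : ℝ := Real.sign x * max (|x| - t) 0

/-- The standard normal density φ(t) = e^{−t²/2}/√(2π). -/
noncomputable def gaussPdf (t : ℝ) : ℝ := Real.exp (-t ^ 2 / 2) / Real.sqrt (2 * Real.pi)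

/-- The Gaussian tail function Q(t) = ∫_t^∞ φ(x) dx. -/
noncomputable def gaussQ (t : ℝ) : ℝ := ∫ x in Set.Ioi t, gaussPdf x

theorem gaussPdf_eq (t : ℝ) :
    gaussPdf t = Real.exp (-(1 / 2) * t ^ 2) * (Real.sqrt (2 * Real.pi))⁻¹ := by
  rw [gaussPdf, div_eq_mul_inv]
  congr 2
  ring

theorem hasDerivAt_gaussPdf (t : ℝ) : HasDerivAt gaussPdf (-t * gaussPdf t) t := by
  have h : HasDerivAt (fun x : ℝ => -x ^ 2 / 2) (-t) t :=
    ((hasDerivAt_pow 2 t).neg.div_const 2).congr_deriv (by norm_num; ring)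
  refine (h.exp.div_const (Real.sqrt (2 * Real.pi))).congr_deriv ?_
  simp only [gaussPdf]
  ring

theorem integrable_pow_mul_gaussPdf (n : ℕ) :
    MeasureTheory.Integrable fun x : ℝ => x ^ n * gaussPdf x := by
  have h := (integrable_rpow_mul_exp_neg_mul_sq (b := 1 / 2) (by norm_num) (s := n)
    (lt_of_lt_of_le (by norm_num) n.cast_nonneg)).mul_const (Real.sqrt (2 * Real.pi))⁻¹
  simpa only [Real.rpow_natCast, gaussPdf_eq, mul_assoc] using h

theorem softThresh_sq {t : ℝ} (ht : 0 < t) (x : ℝ) :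
    softThresh x t ^ 2 = max (|x| - t) 0 ^ 2 := by
  rcases lt_trichotomy x 0 with hx | rfl | hx
  · simp [softThresh, Real.sign_of_neg hx]
  · simp [softThresh, ht.le]
  · simp [softThresh, Real.sign_of_pos hx]

/-- The truncated second moment of `v * Z - c`, by integration by parts. -/
theorem integral_Ioi_sq_mul_gaussPdf (v c a : ℝ) :
    ∫ z in Set.Ioi a, (v * z - c) ^ 2 * gaussPdf z
      = (v ^ 2 + c ^ 2) * gaussQ a - (2 * v * c - v ^ 2 * a) * gaussPdf a := by
  have h0 : MeasureTheory.Integrable gaussPdf := by simpa using integrable_pow_mul_gaussPdf 0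
  have h1 : MeasureTheory.Integrable fun x : ℝ => x * gaussPdf x := by
    simpa using integrable_pow_mul_gaussPdf 1
  have h2 := integrable_pow_mul_gaussPdf 2
  let F : ℝ → ℝ := fun z => (2 * v * c - v ^ 2 * z) * gaussPdf z
  let F' : ℝ → ℝ := fun z => (v * z - c) ^ 2 * gaussPdf z - (v ^ 2 + c ^ 2) * gaussPdf z
  have hderiv (z : ℝ) : HasDerivAt F (F' z) z := by
    have h := (((hasDerivAt_id z).const_mul (v ^ 2)).const_sub (2 * v * c)).mul
      (hasDerivAt_gaussPdf z)
    refine h.congr_deriv ?_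
    simp only [F', id]
    ring
  have hF : MeasureTheory.Integrable F := by
    refine ((h0.const_mul (2 * v * c)).sub (h1.const_mul (v ^ 2))).congr
      (Filter.Eventually.of_forall fun z => ?_)
    simp only [F, Pi.sub_apply]
    ring
  have hsq : MeasureTheory.Integrable fun z => (v * z - c) ^ 2 * gaussPdf z := by
    refine (((h2.const_mul (v ^ 2)).sub (h1.const_mul (2 * v * c))).add
      (h0.const_mul (c ^ 2))).congr (Filter.Eventually.of_forall fun z => ?_)
    simp only [Pi.sub_apply, Pi.add_apply]
    ring
  have hF' : MeasureTheory.Integrable F' := hsq.sub (h0.const_mul _)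
  have hlim := MeasureTheory.tendsto_zero_of_hasDerivAt_of_integrableOn_Ioi (a := a)
    (fun z _ => hderiv z) hF'.integrableOn hF.integrableOn
  have key := MeasureTheory.integral_Ioi_of_hasDerivAt_of_tendsto' (a := a)
    (fun z _ => hderiv z) hF'.integrableOn hlim
  have hsub := MeasureTheory.integral_sub (hsq.integrableOn (s := Set.Ioi a))
    ((h0.const_mul (v ^ 2 + c ^ 2)).integrableOn (s := Set.Ioi a))
  rw [MeasureTheory.integral_const_mul] at hsub
  simp only [F, F'] at key
  rw [gaussQ]
  linarith

/-- For a standard normal Z and v, c > 0: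
E[η(vZ, c)²] = 2·((v² + c²)·Q(c/v) − c·v·φ(c/v)). -/
theorem stmt14 (v c : ℝ) (hv : 0 < v) (hc : 0 < c) :
    ∫ z : ℝ, softThresh (v * z) c ^ 2 * gaussPdf z
      = 2 * ((v ^ 2 + c ^ 2) * gaussQ (c / v) - c * v * gaussPdf (c / v)) := by
  have hfold (z : ℝ) : softThresh (v * z) c ^ 2 * gaussPdf z
      = (fun y : ℝ => max (v * y - c) 0 ^ 2 * gaussPdf y) |z| := by
    simp only [softThresh_sq hc, abs_mul, abs_of_pos hv, gaussPdf, sq_abs]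
  have hsupp : ∫ z in Set.Ioi 0, max (v * z - c) 0 ^ 2 * gaussPdf z
      = ∫ z in Set.Ioi (c / v), (v * z - c) ^ 2 * gaussPdf z := by
    rw [MeasureTheory.setIntegral_eq_of_subset_of_forall_sdiff_eq_zero measurableSet_Ioi
      (Set.Ioi_subset_Ioi (div_pos hc hv).le)]
    · refine MeasureTheory.setIntegral_congr_fun measurableSet_Ioi fun z hz => ?_
      have : c < z * v := (div_lt_iff₀ hv).1 hz
      simp only [max_eq_left (show 0 ≤ v * z - c by linarith)]
    · intro z hz
      have : z * v ≤ c := (le_div_iff₀ hv).1 (not_lt.1 hz.2)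
      rw [max_eq_right (by linarith)]
      simp
  simp_rw [hfold]
  rw [integral_comp_abs (f := fun y : ℝ => max (v * y - c) 0 ^ 2 * gaussPdf y), hsupp,
    integral_Ioi_sq_mul_gaussPdf]
  congr 3
  field_simp
  ring
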